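/- arXiv:2411.08183 — 5 statements merged into one kernel-verified Lean document; each statement's English description precedes it below -/
import Mathlib

section
/- For every integer z ≥ 1 there exist constants c₀ = c₀(z) and N = N(z) with the following property. For every real c ≥ c₀, every integer n ≥ N, every Ψ ⊆ {0,1,…,n} containing an element s with |s − n/2| ≤ n/c, and every subset Z ⊆ [n] with |Z| ≤ z: for every assignment x ∈ {0,1}^Z, the probability that a sample y ∼ D_Ψ agrees with x on all coordinates of Z is at most 2·2^{−|Z|}. -/
open Finset

noncomputable section

/-- Hamming weight of a Boolean string. -/
def hw {n : ℕ} (x : Fin n → Bool) : ℕ := (Finset.univ.filter fun i => x i = true).card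

/-- Uniform distribution on a finite set `C` (zero if `C` is empty). -/
def unifOn {α : Type} [Fintype α] [DecidableEq α] (C : Finset α) : α → ℝ :=
  fun x => if x ∈ C then (C.card : ℝ)⁻¹ else 0

/-- Total variation distance between two (mass functions of) distributions. -/
def tvd {α : Type} [Fintype α] (A B : α → ℝ) : ℝ := (∑ x, |A x - B x|) / 2

/-- Pushforward of a distribution along `f`. -/
def pushf {α β : Type} [Fintype α] [DecidableEq β] (f : α → β) (A : α → ℝ) : β → ℝ :=
  fun y => ∑ x ∈ Finset.univ.filter (fun x => f x = y), A x

/-- `f` is `d`-local: each output coordinate depends on at most `d` input coordinates. -/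
def IsLocal {m n : ℕ} (d : ℕ) (f : (Fin m → Bool) → (Fin n → Bool)) : Prop :=
  ∀ i : Fin n, ∃ T : Finset (Fin m), T.card ≤ d ∧
    ∀ x y : Fin m → Bool, (∀ j ∈ T, x j = y j) → f x i = f y i

/-- `D_Ψ`: uniform distribution on strings whose Hamming weight lies in `Ψ`. -/
def DPsi (n : ℕ) (Ψ : Finset ℕ) : (Fin n → Bool) → ℝ :=
  unifOn (Finset.univ.filter fun x => hw x ∈ Ψ)

/-- The weight distribution of `A`: probability that the Hamming weight equals `k`. -/
def wd {n : ℕ} (A : (Fin n → Bool) → ℝ) (k : ℕ) : ℝ :=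
  ∑ x ∈ Finset.univ.filter (fun x => hw x = k), A x

/-- Total variation distance between the weight distributions of `A` and `B`. -/
def tvW {n : ℕ} (A B : (Fin n → Bool) → ℝ) : ℝ :=
  (∑ k ∈ Finset.range (n + 1), |wd A k - wd B k|) / 2

/-- Symmetrization of the distribution `A`. -/
def symA {n : ℕ} (A : (Fin n → Bool) → ℝ) : (Fin n → Bool) → ℝ :=
  fun x => wd A (hw x) / (n.choose (hw x))

/-- The strings of weight `k` that agree with `x` on `Z`. -/
def levelAgree {n : ℕ} (k : ℕ) (x : Fin n → Bool) (Z : Finset (Fin n)) :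
    Finset (Fin n → Bool) :=
  Finset.univ.filter fun y => hw y = k ∧ ∀ i ∈ Z, y i = x i

theorem hw_comp_perm {n : ℕ} (y : Fin n → Bool) (e : Equiv.Perm (Fin n)) :
    hw (y ∘ e) = hw y := by
  unfold hw
  refine Finset.card_bij (fun i _ => e i) ?_ ?_ ?_
  · intro i hi
    simpa using hi
  · intro i _ j _ h
    exact e.injective h
  · intro i hi
    exact ⟨e.symm i, by simpa using hi, by simp⟩

theorem card_filter_eq_false {n : ℕ} (y : Fin n → Bool) :
    hw y + (Finset.univ.filter fun i => y i = false).card = n := by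
  have h := Finset.card_filter_add_card_filter_not (s := (Finset.univ : Finset (Fin n)))
    (fun i => y i = true)
  simpa [hw] using h

/-- The number of coordinates of `y` equal to `b` is at most `max (hw y) (n - hw y)`. -/
theorem card_filter_eq_le_max {n : ℕ} (y : Fin n → Bool) (b : Bool) :
    (Finset.univ.filter fun i => y i = b).card ≤ max (hw y) (n - hw y) := by
  cases b
  · have := card_filter_eq_false y
    omega
  · exact le_max_left _ _

theorem card_levelAgree_filter_swap {n : ℕ} (k : ℕ) (x : Fin n → Bool) {Z : Finset (Fin n)}
    {i j : Fin n} (hi : i ∉ Z) (hj : j ∉ Z) (b : Bool) :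
    ((levelAgree k x Z).filter fun y => y i = b).card =
      ((levelAgree k x Z).filter fun y => y j = b).card := by
  have key : ∀ l ∈ Z, Equiv.swap i j l = l := fun l hl =>
    Equiv.swap_apply_of_ne_of_ne (fun h => hi (h ▸ hl)) (fun h => hj (h ▸ hl))
  refine Finset.card_nbij' (fun y => y ∘ Equiv.swap i j) (fun y => y ∘ Equiv.swap i j)
    ?_ ?_ ?_ ?_
  · intro y hy
    simp only [levelAgree, Finset.coe_filter, Finset.mem_filter, Finset.mem_univ, true_and,
      Set.mem_ofPred_eq, hw_comp_perm, Function.comp_apply, Equiv.swap_apply_right] at hy ⊢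
    exact ⟨⟨hy.1.1, fun l hl => by rw [key l hl]; exact hy.1.2 l hl⟩, hy.2⟩
  · intro y hy
    simp only [levelAgree, Finset.coe_filter, Finset.mem_filter, Finset.mem_univ, true_and,
      Set.mem_ofPred_eq, hw_comp_perm, Function.comp_apply, Equiv.swap_apply_left] at hy ⊢
    exact ⟨⟨hy.1.1, fun l hl => by rw [key l hl]; exact hy.1.2 l hl⟩, hy.2⟩
  · intro y _
    funext l
    simp
  · intro y _
    funext l
    simp

theorem levelAgree_insert {n : ℕ} (k : ℕ) (x : Fin n → Bool) (Z : Finset (Fin n)) (i : Fin n) :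
    levelAgree k x (insert i Z) = (levelAgree k x Z).filter fun y => y i = x i := by
  ext y
  simp only [levelAgree, Finset.mem_filter, Finset.mem_univ, true_and, Finset.mem_insert,
    forall_eq_or_imp]
  tauto

theorem card_levelAgree_insert_mul_le {n : ℕ} (k : ℕ) (x : Fin n → Bool) {Z : Finset (Fin n)}
    {i : Fin n} (hi : i ∉ Z) :
    (n - Z.card) * (levelAgree k x (insert i Z)).card ≤
      max k (n - k) * (levelAgree k x Z).card := by
  have h1 : (n - Z.card) * (levelAgree k x (insert i Z)).card =
      ∑ j ∈ Zᶜ, ((levelAgree k x Z).filter fun y => y j = x i).card := by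
    rw [levelAgree_insert]
    rw [Finset.sum_congr rfl fun j hj =>
      (card_levelAgree_filter_swap k x hi (Finset.mem_compl.mp hj) (x i)).symm]
    simp [Finset.card_compl]
  rw [h1]
  simp only [Finset.card_filter _ (levelAgree k x Z)]
  rw [Finset.sum_comm, mul_comm, ← smul_eq_mul]
  refine Finset.sum_le_card_nsmul _ _ _ fun y hy => ?_
  rw [← Finset.card_filter]
  have hk : hw y = k := (Finset.mem_filter.mp hy).2.1
  rw [← hk]
  exact (Finset.card_le_card (Finset.filter_subset_filter _ (Finset.subset_univ _))).trans
    (card_filter_eq_le_max y (x i))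

theorem card_levelAgree_empty {n : ℕ} (k : ℕ) (x : Fin n → Bool) :
    (levelAgree k x ∅).card = n.choose k := by
  have h : (Finset.powersetCard k (Finset.univ : Finset (Fin n))).card = n.choose k := by simp
  rw [← h]
  refine Finset.card_bij (fun y _ => Finset.univ.filter fun i => y i = true) ?_ ?_ ?_
  · intro y hy
    simpa [levelAgree, hw, Finset.mem_powersetCard] using hy
  · intro y _ y' _ h
    funext i
    have := Finset.ext_iff.mp h i
    simp only [Finset.mem_filter, Finset.mem_univ, true_and] at this
    exact Bool.eq_iff_iff.mpr this
  · intro S hS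
    refine ⟨fun i => decide (i ∈ S), ?_, by simp⟩
    simpa [levelAgree, hw, Finset.mem_powersetCard] using hS

theorem card_levelAgree_le_choose {n : ℕ} (k : ℕ) (x : Fin n → Bool) (Z : Finset (Fin n)) :
    (levelAgree k x Z).card ≤ n.choose k := by
  rw [← card_levelAgree_empty k x]
  refine Finset.card_le_card fun y hy => ?_
  simp only [levelAgree, Finset.mem_filter] at hy ⊢
  exact ⟨hy.1, hy.2.1, by simp⟩

theorem card_levelAgree_le_pow_mul {n z : ℕ} (k : ℕ) (x : Fin n → Bool) {ρ : ℝ} (hρ : 0 ≤ ρ)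
    (hz : z < n) (hk : ((max k (n - k) : ℕ) : ℝ) ≤ ρ * ((n : ℝ) - z)) (Z : Finset (Fin n)) :
    Z.card ≤ z → ((levelAgree k x Z).card : ℝ) ≤ ρ ^ Z.card * n.choose k := by
  induction Z using Finset.induction_on with
  | empty => simp [card_levelAgree_empty]
  | insert i Z hi ih =>
    intro hc
    rw [Finset.card_insert_of_notMem hi] at hc ⊢
    have ih := ih (by omega)
    have h := card_levelAgree_insert_mul_le k x hi
    have h' : ((n : ℝ) - Z.card) * (levelAgree k x (insert i Z)).card ≤
        ((max k (n - k) : ℕ) : ℝ) * (levelAgree k x Z).card := by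
      rw [← Nat.cast_sub (by omega)]
      exact_mod_cast h
    have hzn : (z : ℝ) < n := by exact_mod_cast hz
    have hZz : (Z.card : ℝ) ≤ z := by exact_mod_cast (by omega : Z.card ≤ z)
    have hpos : (0 : ℝ) < n - z := by linarith
    have h2 : ((n : ℝ) - z) * (levelAgree k x (insert i Z)).card ≤
        ((n : ℝ) - z) * (ρ * (levelAgree k x Z).card) := by
      calc ((n : ℝ) - z) * (levelAgree k x (insert i Z)).card
          ≤ ((n : ℝ) - Z.card) * (levelAgree k x (insert i Z)).card := by gcongr
        _ ≤ _ := h'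
        _ ≤ (ρ * ((n : ℝ) - z)) * (levelAgree k x Z).card := by gcongr
        _ = _ := by ring
    calc ((levelAgree k x (insert i Z)).card : ℝ) ≤ ρ * (levelAgree k x Z).card :=
          le_of_mul_le_mul_left h2 hpos
      _ ≤ ρ * (ρ ^ Z.card * n.choose k) := by gcongr
      _ = _ := by ring

theorem choose_add_le_pow_mul_choose {n p : ℕ} {r : ℝ} (hr : 0 ≤ r)
    (hp : (n : ℝ) - p ≤ r * (p + 1)) (d : ℕ) :
    (n.choose (p + d) : ℝ) ≤ r ^ d * n.choose p := by
  induction d with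
  | zero => simp
  | succ d ih =>
    have h1 : (n.choose (p + d + 1) : ℝ) * ((p + d : ℕ) + 1 : ℝ) ≤
        (r * n.choose (p + d)) * ((p + d : ℕ) + 1 : ℝ) := by
      have h := Nat.choose_succ_right_eq n (p + d)
      rcases le_or_gt (p + d) n with hle | hlt
      · have h' : (n.choose (p + d + 1) : ℝ) * ((p + d : ℕ) + 1 : ℝ) =
            n.choose (p + d) * ((n : ℝ) - (p + d : ℕ)) := by
          rw [← Nat.cast_sub hle]
          exact_mod_cast h
        rw [h', mul_comm r, mul_assoc]
        gcongr
        push_cast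
        nlinarith [mul_nonneg hr (Nat.cast_nonneg (α := ℝ) d), Nat.cast_nonneg (α := ℝ) d]
      · rw [Nat.choose_eq_zero_of_lt (by omega)]
        simp only [Nat.cast_zero, zero_mul]
        positivity
    calc (n.choose (p + (d + 1)) : ℝ) ≤ r * n.choose (p + d) :=
          le_of_mul_le_mul_right h1 (by positivity)
      _ ≤ r * (r ^ d * n.choose p) := by gcongr
      _ = _ := by ring

theorem choose_max_reflect {n k : ℕ} (hk : k ≤ n) : n.choose (max k (n - k)) = n.choose k := by
  rcases le_total k (n - k) with h | h
  · rw [max_eq_right h, Nat.choose_symm hk]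
  · rw [max_eq_left h]

/-- Binomial coefficients far from the middle are negligible, even after multiplication by
`n + 1`, compared with those close to the middle. -/
theorem exists_choose_far_le {δ ε : ℝ} (hδ : 0 < δ) (hδ' : δ < 1 / 2) (hε : 0 < ε) :
    ∃ N : ℕ, ∀ n : ℕ, N ≤ n → ∀ s k : ℕ, s ≤ n → k ≤ n →
      ((max s (n - s) : ℕ) : ℝ) ≤ (1 / 2 + δ) * n →
      (1 / 2 + 2 * δ) * n < ((max k (n - k) : ℕ) : ℝ) →
      ((n : ℝ) + 1) * n.choose k ≤ ε * n.choose s := by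
  set r : ℝ := (1 / 2 - δ) / (1 / 2 + δ) with hr
  have hr0 : 0 ≤ r := div_nonneg (by linarith) (by linarith)
  have hr1 : r < 1 := by rw [hr, div_lt_one (by linarith)]; linarith
  have hlim : Filter.Tendsto (fun d : ℕ => (((d : ℝ) + 1) / δ + 1) * r ^ d) Filter.atTop
      (nhds 0) := by
    have h1 := (tendsto_self_mul_const_pow_of_lt_one hr0 hr1).const_mul (1 / δ)
    have h2 := (tendsto_pow_atTop_nhds_zero_of_lt_one hr0 hr1).const_mul (1 / δ + 1)
    have h3 := h1.add h2
    simp only [mul_zero, add_zero] at h3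
    refine h3.congr fun d => ?_
    ring
  obtain ⟨D, hD⟩ := Filter.eventually_atTop.mp (hlim.eventually (gt_mem_nhds hε))
  refine ⟨⌈((D : ℝ) + 1) / δ⌉₊, fun n hn s k hs hk hs' hk' => ?_⟩
  have hnD : (D : ℝ) + 1 ≤ n * δ := by
    rw [← div_le_iff₀ hδ]
    exact Nat.ceil_le.mp hn
  rw [← choose_max_reflect hs, ← choose_max_reflect hk]
  have hsn : n ≤ 2 * max s (n - s) := by omega
  set s' := max s (n - s)
  set k' := max k (n - k)
  set p := ⌈(1 / 2 + δ) * (n : ℝ)⌉₊ with hp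
  have hn0 : (0 : ℝ) ≤ n := Nat.cast_nonneg n
  have hp1 : (1 / 2 + δ) * (n : ℝ) ≤ p := Nat.le_ceil _
  have hp2 : (p : ℝ) < (1 / 2 + δ) * (n : ℝ) + 1 := Nat.ceil_lt_add_one (by positivity)
  have hsp : s' ≤ p := by exact_mod_cast hs'.trans hp1
  have hpk : p ≤ k' := by
    have : (p : ℝ) < k' + 1 := by nlinarith
    exact_mod_cast Nat.lt_succ_iff.mp (by exact_mod_cast this)
  obtain ⟨a, ha⟩ := Nat.exists_eq_add_of_le hsp
  obtain ⟨d, hd⟩ := Nat.exists_eq_add_of_le hpk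
  have hsn' : (n : ℝ) ≤ 2 * s' := by exact_mod_cast hsn
  have h1 : (n.choose p : ℝ) ≤ n.choose s' := by
    have := choose_add_le_pow_mul_choose (n := n) (p := s') (r := 1) zero_le_one
      (by linarith) a
    simpa [ha] using this
  have h2 : (n.choose k' : ℝ) ≤ r ^ d * n.choose p := by
    rw [hd]
    refine choose_add_le_pow_mul_choose hr0 ?_ d
    have h3 : (1 / 2 - δ) * (n : ℝ) = r * ((1 / 2 + δ) * n) := by
      rw [hr]
      field_simp
    calc (n : ℝ) - p ≤ (1 / 2 - δ) * n := by linarith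
      _ = r * ((1 / 2 + δ) * n) := h3
      _ ≤ r * (p + 1) := by gcongr; linarith
  have hdn : (n : ℝ) * δ ≤ d + 1 := by
    have : (k' : ℝ) = p + d := by exact_mod_cast hd
    linarith
  have hdD : D ≤ d := by
    have : (D : ℝ) ≤ d := by linarith
    exact_mod_cast this
  have h4 := (hD d hdD).le
  have h5 : (n : ℝ) + 1 ≤ ((d : ℝ) + 1) / δ + 1 := by
    have : (n : ℝ) ≤ ((d : ℝ) + 1) / δ := by rwa [le_div_iff₀ hδ]
    linarith
  calc ((n : ℝ) + 1) * n.choose k' ≤ (((d : ℝ) + 1) / δ + 1) * (r ^ d * n.choose s') := by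
        gcongr
        exact h2.trans (by gcongr)
    _ = ((((d : ℝ) + 1) / δ + 1) * r ^ d) * n.choose s' := by ring
    _ ≤ ε * n.choose s' := by gcongr

theorem sum_DPsi_agree_eq {n : ℕ} (Ψ : Finset ℕ) (Z : Finset (Fin n)) (x : Fin n → Bool) :
    (∑ y ∈ Finset.univ.filter (fun y : Fin n → Bool => ∀ i ∈ Z, y i = x i), DPsi n Ψ y) =
      (∑ k ∈ Ψ, ((levelAgree k x Z).card : ℝ)) / ∑ k ∈ Ψ, (n.choose k : ℝ) := by
  have hcard : ∀ W : Finset (Fin n),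
      (Finset.univ.filter fun y : Fin n → Bool => (∀ i ∈ W, y i = x i) ∧ hw y ∈ Ψ).card =
        ∑ k ∈ Ψ, (levelAgree k x W).card := by
    intro W
    rw [Finset.card_eq_sum_card_fiberwise (f := hw) (t := Ψ)
      (fun y hy => (Finset.mem_filter.mp hy).2.2)]
    refine Finset.sum_congr rfl fun k hk => congrArg Finset.card ?_
    ext y
    simp only [levelAgree, Finset.mem_filter, Finset.mem_univ, true_and]
    constructor
    · rintro ⟨⟨h1, _⟩, h2⟩
      exact ⟨h2, h1⟩
    · rintro ⟨h2, h1⟩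
      exact ⟨⟨h1, h2 ▸ hk⟩, h2⟩
  have htot := hcard ∅
  simp only [Finset.notMem_empty, false_imp_iff, implies_true, true_and,
    card_levelAgree_empty] at htot
  have hZ := hcard Z
  rw [← Nat.cast_sum, ← Nat.cast_sum, ← htot, ← hZ]
  simp only [DPsi, unifOn, Finset.mem_filter, Finset.mem_univ, true_and]
  rw [← Finset.sum_filter, Finset.filter_filter, Finset.sum_const, nsmul_eq_mul, div_eq_mul_inv]

/-- Marginals of `D_Ψ` on few coordinates are within a factor of two of uniform. -/
theorem stmt10 :
    ∀ z : ℕ, 1 ≤ z → ∃ c₀ : ℝ, ∃ N : ℕ, ∀ c : ℝ, c₀ ≤ c → ∀ n : ℕ, N ≤ n →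
    ∀ Ψ : Finset ℕ, Ψ ⊆ Finset.range (n + 1) →
    (∃ s ∈ Ψ, |(s : ℝ) - n / 2| ≤ n / c) →
    ∀ Z : Finset (Fin n), Z.card ≤ z → ∀ x : Fin n → Bool,
      (∑ y ∈ Finset.univ.filter (fun y : Fin n → Bool => ∀ i ∈ Z, y i = x i), DPsi n Ψ y)
        ≤ 2 * ((2 : ℝ) ^ Z.card)⁻¹ := by
  intro z hz
  have hz0 : (1 : ℝ) ≤ z := by exact_mod_cast hz
  set δ : ℝ := 1 / (18 * z) with hδdef
  have hδz : δ * z = 1 / 18 := by rw [hδdef]; field_simp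
  have hδ : 0 < δ := by positivity
  have hδ' : δ ≤ 1 / 18 := by nlinarith
  obtain ⟨N, hN⟩ := exists_choose_far_le (ε := 1 / 2 * ((2 : ℝ) ^ z)⁻¹) hδ (by linarith)
    (by positivity)
  refine ⟨1 / δ, max N ⌈(z : ℝ) / δ⌉₊, ?_⟩
  rintro c hc n hn Ψ hΨ ⟨s, hsΨ, hs⟩ Z hZ x
  have hnN : N ≤ n := (le_max_left _ _).trans hn
  have hnz : (z : ℝ) ≤ n * δ := by
    rw [← div_le_iff₀ hδ]
    exact Nat.ceil_le.mp ((le_max_right _ _).trans hn)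
  have hzn : (z : ℝ) < n := by nlinarith
  have hn0 : (0 : ℝ) ≤ n := Nat.cast_nonneg n
  have hmem : ∀ k ∈ Ψ, k ≤ n := fun k hk => Nat.lt_succ_iff.mp (Finset.mem_range.mp (hΨ hk))
  have hsn := hmem s hsΨ
  have hnc : (n : ℝ) / c ≤ δ * n := by
    have hc0 : 0 < c := lt_of_lt_of_le (by positivity) hc
    rw [div_le_iff₀ hc0]
    have : 1 ≤ c * δ := (div_le_iff₀ hδ).mp hc
    nlinarith
  have hs' : ((max s (n - s) : ℕ) : ℝ) ≤ (1 / 2 + δ) * n := by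
    have := abs_le.mp (hs.trans hnc)
    rw [Nat.cast_max, Nat.cast_sub hsn]
    exact max_le (by linarith) (by linarith)
  have hpow : (1 + 6 * δ) ^ Z.card ≤ 3 / 2 := by
    have h1 : (1 + 6 * δ) ^ Z.card ≤ (1 + 6 * δ) ^ z := pow_le_pow_right₀ (by linarith) hZ
    have h2 : (1 + 6 * δ) ^ z ≤ Real.exp (1 / 3) := by
      calc (1 + 6 * δ) ^ z ≤ Real.exp (6 * δ) ^ z := by
            gcongr
            linarith [Real.add_one_le_exp (6 * δ)]
        _ = Real.exp (1 / 3) := by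
            rw [← Real.exp_nat_mul]
            congr 1
            linarith
    have h3 : Real.exp (1 / 3) ≤ 3 / 2 := by
      have h4 := Real.one_sub_le_exp_neg (1 / 3)
      have h5 : Real.exp (1 / 3) * Real.exp (-(1 / 3)) = 1 := by rw [← Real.exp_add]; simp
      nlinarith [Real.exp_pos (1 / 3)]
    linarith
  have hlevel : ∀ k ∈ Ψ, ((levelAgree k x Z).card : ℝ) ≤
      3 / 2 * ((2 : ℝ) ^ Z.card)⁻¹ * n.choose k +
        1 / 2 * ((2 : ℝ) ^ z)⁻¹ * n.choose s / (n + 1) := by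
    intro k hk
    rcases le_or_gt ((max k (n - k) : ℕ) : ℝ) ((1 / 2 + 2 * δ) * n) with hnear | hfar
    · have h := card_levelAgree_le_pow_mul k x (ρ := 1 / 2 * (1 + 6 * δ)) (by positivity)
        (by exact_mod_cast hzn) (z := z)
        (hnear.trans (by nlinarith [mul_nonneg hδ.le hn0])) Z hZ
      have h2 : (1 / 2 * (1 + 6 * δ)) ^ Z.card * (n.choose k : ℝ) ≤
          3 / 2 * ((2 : ℝ) ^ Z.card)⁻¹ * n.choose k := by
        gcongr
        rw [mul_pow, one_div, inv_pow, mul_comm]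
        gcongr
      have h3 : 0 ≤ 1 / 2 * ((2 : ℝ) ^ z)⁻¹ * n.choose s / (n + 1) := by positivity
      linarith
    · have h := hN n hnN s k hsn (hmem k hk) hs' hfar
      have h1 : ((levelAgree k x Z).card : ℝ) ≤ n.choose k := by
        exact_mod_cast card_levelAgree_le_choose k x Z
      have h2 : (n.choose k : ℝ) ≤ 1 / 2 * ((2 : ℝ) ^ z)⁻¹ * n.choose s / (n + 1) := by
        rw [le_div_iff₀ (by positivity)]
        linarith
      have h3 : 0 ≤ 3 / 2 * ((2 : ℝ) ^ Z.card)⁻¹ * n.choose k := by positivity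
      linarith
  have hle : (n.choose s : ℝ) ≤ ∑ k ∈ Ψ, (n.choose k : ℝ) :=
    Finset.single_le_sum (f := fun k => (n.choose k : ℝ)) (fun _ _ => Nat.cast_nonneg _) hsΨ
  have hpos : (0 : ℝ) < n.choose s := by exact_mod_cast Nat.choose_pos hsn
  have hΨcard : (Ψ.card : ℝ) ≤ n + 1 := by
    exact_mod_cast (Finset.card_le_card hΨ).trans_eq (Finset.card_range _)
  rw [sum_DPsi_agree_eq, div_le_iff₀ (hpos.trans_le hle)]
  calc (∑ k ∈ Ψ, ((levelAgree k x Z).card : ℝ))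
      ≤ ∑ k ∈ Ψ, (3 / 2 * ((2 : ℝ) ^ Z.card)⁻¹ * n.choose k +
        1 / 2 * ((2 : ℝ) ^ z)⁻¹ * n.choose s / (n + 1)) := Finset.sum_le_sum hlevel
    _ = 3 / 2 * ((2 : ℝ) ^ Z.card)⁻¹ * ∑ k ∈ Ψ, (n.choose k : ℝ) +
        Ψ.card / ((n : ℝ) + 1) * (1 / 2 * ((2 : ℝ) ^ z)⁻¹ * n.choose s) := by
      rw [Finset.sum_add_distrib, ← Finset.mul_sum, Finset.sum_const, nsmul_eq_mul]
      ring
    _ ≤ 3 / 2 * ((2 : ℝ) ^ Z.card)⁻¹ * ∑ k ∈ Ψ, (n.choose k : ℝ) +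
        1 * (1 / 2 * ((2 : ℝ) ^ Z.card)⁻¹ * ∑ k ∈ Ψ, (n.choose k : ℝ)) := by
      gcongr
      · exact (div_le_one (by positivity)).mpr hΨcard
      · norm_num
    _ = 2 * ((2 : ℝ) ^ Z.card)⁻¹ * ∑ k ∈ Ψ, (n.choose k : ℝ) := by ring
end
end

section
/- There exists a function N(c) such that the following holds. Let c > 4 be a real number, let n ≥ N(c) be an integer, and let Ψ ⊆ {0,1,…,n} be a set containing an element s₀ with |s₀ − n/2| ≤ n/c. Then the probability that a sample x ∼ D_Ψ has Hamming weight s = |x| satisfying |s − n/2| > 2n/c is at most √(8n·(1/2 − 1/c)²)·2^{−n/c²}. -/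
open Finset

noncomputable section

/-- There are `n.choose k` Boolean strings of Hamming weight `k`. -/
theorem card_hw_eq (n k : ℕ) :
    (Finset.univ.filter fun x : Fin n → Bool => hw x = k).card = n.choose k := by
  have h : (Finset.powersetCard k (Finset.univ : Finset (Fin n))).card = n.choose k := by
    simp
  rw [← h]
  refine Finset.card_bij' (fun x _ => Finset.univ.filter fun i => x i = true)
    (fun s _ => fun i => decide (i ∈ s)) ?_ ?_ ?_ ?_
  · intro x hx
    exact Finset.mem_powersetCard.2 ⟨Finset.subset_univ _, (Finset.mem_filter.1 hx).2⟩
  · intro s hs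
    refine Finset.mem_filter.2 ⟨Finset.mem_univ _, ?_⟩
    simpa [hw] using hs
  · intro x _
    ext i
    simp
  · intro s _
    ext i
    simp

/-- Geometric decay of binomial coefficients to the right of `n (1 + y) / 2`. -/
theorem choose_add_le_exp_mul_choose {n m : ℕ} {y : ℝ} (hy : 0 ≤ y)
    (hm : (n : ℝ) * (1 + y) / 2 ≤ m) (d : ℕ) :
    (n.choose (m + d) : ℝ) ≤ Real.exp (-(y * d)) * n.choose m := by
  induction d with
  | zero => simp
  | succ d ih =>
    have hstep : (n.choose (m + d + 1) : ℝ) ≤ Real.exp (-y) * n.choose (m + d) := by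
      rcases lt_or_ge n (m + d + 1) with hlt | hge
      · rw [Nat.choose_eq_zero_of_lt hlt, Nat.cast_zero]
        positivity
      · have h := Nat.choose_succ_right_eq n (m + d)
        have h' : (n.choose (m + d + 1) : ℝ) * (m + d + 1) = n.choose (m + d) * (n - (m + d)) := by
          rw [← Nat.cast_add, ← Nat.cast_sub (by omega : m + d ≤ n)]
          exact_mod_cast h
        have hexp : 1 - y ≤ Real.exp (-y) := by linarith [Real.add_one_le_exp (-y)]
        have hn : (0 : ℝ) ≤ n := n.cast_nonneg
        have hd : (0 : ℝ) ≤ d := d.cast_nonneg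
        have hpos : (0 : ℝ) < m + d + 1 := by positivity
        have hratio : (n : ℝ) - (m + d) ≤ Real.exp (-y) * (m + d + 1) := by
          have h1 : (n : ℝ) / 2 ≤ m + d + 1 := by nlinarith [mul_nonneg hn hy]
          have h2 : (n : ℝ) / 2 * (1 - y) ≤ n / 2 * Real.exp (-y) := by gcongr
          have h3 : (n : ℝ) / 2 * Real.exp (-y) ≤ (m + d + 1) * Real.exp (-y) := by gcongr
          linarith
        refine le_of_mul_le_mul_right ?_ hpos
        calc (n.choose (m + d + 1) : ℝ) * (m + d + 1) = n.choose (m + d) * (n - (m + d)) := h'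
          _ ≤ n.choose (m + d) * (Real.exp (-y) * (m + d + 1)) := by gcongr
          _ = Real.exp (-y) * n.choose (m + d) * (m + d + 1) := by ring
    calc (n.choose (m + (d + 1)) : ℝ) ≤ Real.exp (-y) * n.choose (m + d) := hstep
      _ ≤ Real.exp (-y) * (Real.exp (-(y * d)) * n.choose m) := by gcongr
      _ = Real.exp (-(y * (d + 1 : ℕ))) * n.choose m := by
        rw [← mul_assoc, ← Real.exp_add]
        congr 2
        push_cast
        ring

/-- Every binomial coefficient equals one in the right half, at the same distance from `n / 2`. -/
theorem exists_choose_eq_right_half {n k : ℕ} (hk : k ≤ n) :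
    ∃ j : ℕ, n.choose j = n.choose k ∧ (j : ℝ) = n / 2 + |(k : ℝ) - n / 2| := by
  rcases le_total ((n : ℝ) / 2) k with h | h
  · exact ⟨k, rfl, by rw [abs_of_nonneg (by linarith)]; ring⟩
  · refine ⟨n - k, Nat.choose_symm hk, ?_⟩
    rw [abs_of_nonpos (by linarith), Nat.cast_sub hk]
    ring

theorem choose_far_le_choose_near {n s t : ℕ} {c : ℝ} (hc : 2 ≤ c) (hs : s ≤ n) (ht : t ≤ n)
    (hsc : |(s : ℝ) - n / 2| ≤ n / c) (htc : 2 * n / c < |(t : ℝ) - n / 2|) :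
    (n.choose t : ℝ) ≤ Real.exp (1 - 2 * (n / c ^ 2)) * n.choose s := by
  obtain ⟨s', hs', hs'eq⟩ := exists_choose_eq_right_half hs
  obtain ⟨t', ht', ht'eq⟩ := exists_choose_eq_right_half ht
  rw [← hs', ← ht']
  have hc0 : 0 < c := by linarith
  have hnc : (0 : ℝ) ≤ n / c := by positivity
  have h2 : 2 * (n : ℝ) / c = n / c + n / c := by ring
  obtain ⟨m, hm⟩ : ∃ m : ℕ, m = ⌈(n : ℝ) / 2 + n / c⌉₊ := ⟨_, rfl⟩
  have hm1 : (n : ℝ) / 2 + n / c ≤ m := hm ▸ Nat.le_ceil _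
  have hm2 : (m : ℝ) < n / 2 + n / c + 1 := hm ▸ Nat.ceil_lt_add_one (by positivity)
  have hsm : s' ≤ m := by
    have : (s' : ℝ) ≤ m := by linarith
    exact_mod_cast this
  have hmt : m ≤ t' := by
    rw [hm]
    exact Nat.ceil_le.2 (by linarith)
  obtain ⟨a, rfl⟩ := Nat.exists_eq_add_of_le hsm
  obtain ⟨b, rfl⟩ := Nat.exists_eq_add_of_le hmt
  have hA := choose_add_le_exp_mul_choose (n := n) (m := s') le_rfl
    (by linarith [abs_nonneg ((s : ℝ) - n / 2)]) a
  have hB := choose_add_le_exp_mul_choose (n := n) (m := s' + a) (y := 2 / c) (by positivity)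
    (by
      have : (n : ℝ) * (1 + 2 / c) / 2 = n / 2 + n / c := by ring
      linarith) b
  simp only [zero_mul, neg_zero, Real.exp_zero, one_mul] at hA
  refine hB.trans (mul_le_mul (Real.exp_le_exp.2 ?_) hA (by positivity) (by positivity))
  have hb : (n : ℝ) / c - 1 ≤ b := by
    rw [Nat.cast_add _ b] at ht'eq
    linarith
  have h3 : 2 / c * ((n : ℝ) / c - 1) ≤ 2 / c * b := by gcongr
  have h4 : 2 / c * ((n : ℝ) / c - 1) = 2 * (n / c ^ 2) - 2 / c := by
    field_simp
  have h5 : 2 / c ≤ 1 := (div_le_one hc0).2 hc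
  linarith

theorem sum_unifOn {α : Type} [Fintype α] [DecidableEq α] (C E : Finset α) :
    ∑ x ∈ E, unifOn C x = (E ∩ C).card / C.card := by
  simp only [unifOn]
  rw [← Finset.sum_filter, Finset.filter_mem_eq_inter, Finset.sum_const, nsmul_eq_mul,
    div_eq_mul_inv]

theorem hw_le {n : ℕ} (x : Fin n → Bool) : hw x ≤ n := by
  simpa [hw] using Finset.card_le_univ (Finset.univ.filter fun i => x i = true)

/-- If every weight occurring in `A` has at most `B` strings, then `A` has at most `(n + 1) B`
strings. -/
theorem card_le_mul_of_choose_le {n : ℕ} {B : ℝ} (A : Finset (Fin n → Bool))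
    (hB : ∀ x ∈ A, (n.choose (hw x) : ℝ) ≤ B) (hB0 : 0 ≤ B) :
    (A.card : ℝ) ≤ (n + 1) * B := by
  have h := Finset.card_eq_sum_card_fiberwise (f := hw) (s := A) (t := Finset.range (n + 1))
    (fun x _ => by simpa [Nat.lt_succ_iff] using hw_le x)
  rw [h, Nat.cast_sum]
  refine (Finset.sum_le_card_nsmul _ _ B fun k _ => ?_).trans (by simp)
  rcases (A.filter fun x => hw x = k).eq_empty_or_nonempty with he | ⟨x, hx⟩
  · simpa [he] using hB0
  · obtain ⟨hxA, rfl⟩ := Finset.mem_filter.1 hx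
    refine le_trans ?_ (hB x hxA)
    rw [← card_hw_eq]
    exact_mod_cast Finset.card_le_card (Finset.filter_subset_filter _ (Finset.subset_univ A))

theorem succ_mul_exp_le {n : ℕ} {c : ℝ} (hc : 4 < c) (hn : 24 * c ^ 4 ≤ n) :
    ((n : ℝ) + 1) * Real.exp (1 - 2 * (n / c ^ 2)) ≤
      Real.sqrt (8 * n * (1 / 2 - 1 / c) ^ 2) * (2 : ℝ) ^ (-(n : ℝ) / c ^ 2) := by
  have hc0 : 0 < c := by linarith
  have hc4 : 1 ≤ c ^ 4 := one_le_pow₀ (by linarith)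
  have hn1 : (1 : ℝ) ≤ n := by linarith
  set z : ℝ := n / c ^ 2 with hz
  have hz0 : 0 ≤ z := by positivity
  have hsqrt : 1 / 2 ≤ Real.sqrt (8 * n * (1 / 2 - 1 / c) ^ 2) := by
    apply Real.le_sqrt_of_sq_le
    have h1 : 1 / c ≤ 1 / 4 := by gcongr
    have h2 : (1 / 4 : ℝ) ^ 2 ≤ (1 / 2 - 1 / c) ^ 2 := by
      gcongr
      linarith
    nlinarith
  have htwo : Real.exp (-z) ≤ (2 : ℝ) ^ (-(n : ℝ) / c ^ 2) := by
    rw [Real.rpow_def_of_pos two_pos, neg_div, ← hz]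
    apply Real.exp_le_exp.2
    nlinarith [Real.log_two_lt_d9]
  have hquad : 12 * (n : ℝ) ≤ Real.exp z := by
    have h1 : z ^ 2 / 2 ≤ Real.exp z := by linarith [Real.quadratic_le_exp_of_nonneg hz0]
    have h2 : 12 * (n : ℝ) ≤ z ^ 2 / 2 := by
      have : z ^ 2 / 2 = n * n / (2 * c ^ 4) := by
        rw [hz]
        field_simp
      rw [this, le_div_iff₀ (by positivity)]
      nlinarith
    linarith
  have hmain : ((n : ℝ) + 1) * Real.exp (1 - 2 * z) ≤ 1 / 2 * Real.exp (-z) := by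
    have h1 : Real.exp (1 - 2 * z) = Real.exp 1 * Real.exp (-z) * Real.exp (-z) := by
      rw [← Real.exp_add, ← Real.exp_add]
      congr 1
      ring
    have h2 : ((n : ℝ) + 1) * Real.exp 1 ≤ 1 / 2 * Real.exp z := by
      nlinarith [Real.exp_one_lt_d9]
    have h3 : Real.exp z * Real.exp (-z) = 1 := by
      rw [← Real.exp_add]
      simp
    calc ((n : ℝ) + 1) * Real.exp (1 - 2 * z)
        = ((n : ℝ) + 1) * Real.exp 1 * (Real.exp (-z) * Real.exp (-z)) := by rw [h1]; ring
      _ ≤ 1 / 2 * Real.exp z * (Real.exp (-z) * Real.exp (-z)) := by gcongr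
      _ = 1 / 2 * (Real.exp z * Real.exp (-z)) * Real.exp (-z) := by ring
      _ = 1 / 2 * Real.exp (-z) := by rw [h3]; ring
  exact hmain.trans (mul_le_mul hsqrt htwo (by positivity) (by positivity))

open scoped Classical in
/-- The weight of a sample from a roughly centered `D_Ψ` is concentrated near `n/2`. -/
theorem stmt11 :
    ∃ N : ℝ → ℕ, ∀ c : ℝ, 4 < c → ∀ n : ℕ, N c ≤ n →
    ∀ Ψ : Finset ℕ, Ψ ⊆ Finset.range (n + 1) →
    (∃ s₀ ∈ Ψ, |(s₀ : ℝ) - n / 2| ≤ n / c) →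
    (∑ x ∈ Finset.univ.filter
        (fun x : Fin n → Bool => 2 * n / c < |(hw x : ℝ) - n / 2|), DPsi n Ψ x)
      ≤ Real.sqrt (8 * n * (1 / 2 - 1 / c) ^ 2) * (2 : ℝ) ^ (-(n : ℝ) / c ^ 2) := by
  refine ⟨fun c => ⌈24 * c ^ 4⌉₊, fun c hc n hn Ψ hΨ ⟨s₀, hs₀, hs₀c⟩ => ?_⟩
  refine le_trans ?_ (succ_mul_exp_le hc (Nat.ceil_le.1 hn))
  have hs₀n : s₀ ≤ n := Nat.lt_succ_iff.1 (Finset.mem_range.1 (hΨ hs₀))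
  have hpos : (0 : ℝ) < n.choose s₀ := by exact_mod_cast Nat.choose_pos hs₀n
  have hcard : (n.choose s₀ : ℝ) ≤
      (Finset.univ.filter fun x : Fin n → Bool => hw x ∈ Ψ).card := by
    rw [← card_hw_eq]
    exact_mod_cast Finset.card_le_card fun x hx => by
      simp only [Finset.mem_filter, Finset.mem_univ, true_and] at hx ⊢
      exact hx ▸ hs₀
  simp only [DPsi]
  rw [sum_unifOn, div_le_iff₀ (hpos.trans_le hcard), mul_assoc]
  refine (card_le_mul_of_choose_le _ (fun x hx => ?_) (by positivity)).trans
    (mul_le_mul_of_nonneg_left (mul_le_mul_of_nonneg_left hcard (by positivity)) (by positivity))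
  simp only [Finset.mem_inter, Finset.mem_filter, Finset.mem_univ, true_and] at hx
  exact choose_far_le_choose_near (by linarith) hs₀n (hw_le x) hs₀c hx.1
end
end

section
/- For every real number c > 4, the binary entropy function satisfies H(1/2 − 2/c) − H(1/2 − 1/c) ≤ −1/c². -/
/-- The binary entropy function (with logarithms base 2). -/
noncomputable def binEnt (p : ℝ) : ℝ := -(p * Real.logb 2 p) - (1 - p) * Real.logb 2 (1 - p)

/-- Gibbs' inequality, one term: `p * log (q / p) ≤ q - p`. -/
lemma mul_log_sub_log_le {p q : ℝ} (hp : 0 < p) (hq : 0 < q) :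
    p * (Real.log q - Real.log p) ≤ q - p := by
  have h := Real.log_le_sub_one_of_pos (div_pos hq hp)
  rw [Real.log_div hq.ne' hp.ne'] at h
  calc p * (Real.log q - Real.log p) ≤ p * (q / p - 1) := by gcongr
    _ = q - p := by field_simp

lemma binEnt_eq_div_log_two (p : ℝ) :
    binEnt p = (-(p * Real.log p) - (1 - p) * Real.log (1 - p)) / Real.log 2 := by
  simp only [binEnt, Real.logb]
  ring

/-- For every `c > 4`, `H(1/2 − 2/c) − H(1/2 − 1/c) ≤ −1/c²`. -/
theorem stmt12 (c : ℝ) (hc : 4 < c) :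
    binEnt (1 / 2 - 2 / c) - binEnt (1 / 2 - 1 / c) ≤ -(1 / c ^ 2) := by
  obtain ⟨x, hx⟩ : ∃ x, x = 1 / c := ⟨_, rfl⟩
  have hx0 : 0 < x := by rw [hx]; positivity
  have hx4 : x < 1 / 4 := by
    rw [hx]
    exact one_div_lt_one_div_of_lt (by norm_num) hc
  rw [show 2 / c = 2 * x by rw [hx]; ring, show 1 / c ^ 2 = x ^ 2 by rw [hx]; ring, ← hx,
    binEnt_eq_div_log_two, binEnt_eq_div_log_two, ← sub_div, div_le_iff₀ (Real.log_pos one_lt_two),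
    show 1 - (1 / 2 - 2 * x) = 1 / 2 + 2 * x by ring, show 1 - (1 / 2 - x) = 1 / 2 + x by ring]
  have hp := mul_log_sub_log_le (p := 1 / 2 - 2 * x) (q := 1 / 2 - x) (by linarith) (by linarith)
  have hp' := mul_log_sub_log_le (p := 1 / 2 + 2 * x) (q := 1 / 2 + x) (by linarith) (by linarith)
  have hslope :=
    mul_log_sub_log_le (p := 1 / 2 + x) (q := 1 / 2 - x) (by linarith) (by linarith)
  have hlog : Real.log 2 ≤ 1 := by linarith [Real.log_two_lt_d9]
  have hdiff : x ≤ Real.log (1 / 2 + x) - Real.log (1 / 2 - x) := by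
    by_contra! h
    nlinarith
  nlinarith [mul_le_mul_of_nonneg_left hdiff hx0.le,
    mul_le_mul_of_nonneg_left hlog (sq_nonneg x)]
end

section
/- Let d and k be positive integers, let f : {0,1}^m → {0,1}^n be a d-local function, and let S ⊆ [n] be a nonempty set with |S| ≤ k. Then the expectation E_{x ∼ U^m}[∏_{i ∈ S} (−1)^{f(x)_i}] is an integer multiple of 2^{−k·d}. -/
open Finset

noncomputable section

/-- The sum over the Boolean cube of a function depending only on the coordinates in `T` is
divisible by `2` to the number of remaining coordinates. -/
theorem two_pow_dvd_sum_of_dependsOn {ι : Type*} [Fintype ι] [DecidableEq ι] (T : Finset ι)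
    (g : (ι → Bool) → ℤ) (hg : ∀ x y : ι → Bool, (∀ j ∈ T, x j = y j) → g x = g y) :
    (2 : ℤ) ^ (Fintype.card ι - T.card) ∣ ∑ x, g x := by
  let e := Equiv.piEquivPiSubtypeProd (fun i => i ∈ T) (fun _ : ι => Bool)
  rw [← e.symm.sum_comp, Fintype.sum_prod_type]
  refine Finset.dvd_sum fun a _ => ?_
  have hconst : ∀ b, g (e.symm (a, b)) = g (e.symm (a, fun _ => false)) := fun b =>
    hg _ _ fun j hj => by simp [e, Equiv.piEquivPiSubtypeProd, hj]
  rw [Finset.sum_congr rfl fun b _ => hconst b]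
  simp [Fintype.card_subtype_compl]

/-- The Fourier coefficient (expected parity) of at most `k` output bits of a `d`-local
function is an integer multiple of `2^{-kd}`. -/
theorem stmt13 {m n : ℕ} (d k : ℕ) (hd : 1 ≤ d) (hk : 1 ≤ k)
    (f : (Fin m → Bool) → (Fin n → Bool)) (hf : IsLocal d f)
    (S : Finset (Fin n)) (hS : S.Nonempty) (hSk : S.card ≤ k) :
    ∃ z : ℤ,
      (∑ x : Fin m → Bool, ∏ i ∈ S, (if f x i = true then (-1 : ℝ) else 1)) / 2 ^ m
        = (z : ℝ) * ((2 : ℝ) ^ (k * d))⁻¹ := by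
  classical
  choose T hTcard hT using hf
  let g : (Fin m → Bool) → ℤ := fun x => ∏ i ∈ S, if f x i = true then -1 else 1
  have hg : ∀ x y : Fin m → Bool, (∀ j ∈ S.biUnion T, x j = y j) → g x = g y :=
    fun x y hxy => Finset.prod_congr rfl fun i hi => by
      rw [hT i x y fun j hj => hxy j (Finset.mem_biUnion.2 ⟨i, hi, hj⟩)]
  have hcard : (S.biUnion T).card ≤ k * d :=
    (Finset.card_biUnion_le_card_mul S T d fun i _ => hTcard i).trans
      (Nat.mul_le_mul_right d hSk)
  obtain ⟨c, hc⟩ := two_pow_dvd_sum_of_dependsOn (S.biUnion T) g hg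
  rw [Fintype.card_fin] at hc
  have hle : (S.biUnion T).card ≤ m := by simpa using Finset.card_le_univ (S.biUnion T)
  have hsum : (∑ x : Fin m → Bool, ∏ i ∈ S, (if f x i = true then (-1 : ℝ) else 1))
      = (2 : ℝ) ^ (m - (S.biUnion T).card) * c := by
    have h := congrArg (Int.cast : ℤ → ℝ) hc
    simpa [g] using h
  refine ⟨2 ^ (k * d - (S.biUnion T).card) * c, ?_⟩
  rw [hsum, ← div_eq_mul_inv, div_eq_div_iff (by positivity) (by positivity)]
  push_cast
  have hpow : (2 : ℝ) ^ (m - (S.biUnion T).card) * 2 ^ (k * d)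
      = 2 ^ (k * d - (S.biUnion T).card) * 2 ^ m := by
    rw [← pow_add, ← pow_add]
    congr 1
    omega
  linear_combination (c : ℝ) * hpow
end
end

section
/- Let A be a probability distribution on {0,1}^n and let M and D be symmetric probability distributions on {0,1}^n. Then dTV(A, M) ≤ dTV(|A|, |M|) + 3·dTV(A, D). -/
open Finset

noncomputable section

theorem hw_mem_range {n : ℕ} (x : Fin n → Bool) : hw x ∈ range (n + 1) :=
  mem_range_succ_iff.2 <| (card_le_univ _).trans_eq (Fintype.card_fin n)

theorem tvd_triangle {α : Type} [Fintype α] (A B C : α → ℝ) :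
    tvd A C ≤ tvd A B + tvd B C := by
  unfold tvd
  rw [← add_div, ← sum_add_distrib]
  gcongr
  exact abs_sub_le _ _ _

theorem tvW_triangle {n : ℕ} (A B C : (Fin n → Bool) → ℝ) :
    tvW A C ≤ tvW A B + tvW B C := by
  unfold tvW
  rw [← add_div, ← sum_add_distrib]
  gcongr
  exact abs_sub_le _ _ _

theorem tvd_comm {α : Type} [Fintype α] (A B : α → ℝ) : tvd A B = tvd B A := by
  simp only [tvd, abs_sub_comm]

theorem tvd_nonneg {α : Type} [Fintype α] (A B : α → ℝ) : 0 ≤ tvd A B := by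
  unfold tvd
  positivity

/-- Passing to the weight distributions does not increase the total variation distance. -/
theorem tvW_le_tvd {n : ℕ} (A B : (Fin n → Bool) → ℝ) : tvW A B ≤ tvd A B := by
  unfold tvW tvd wd
  rw [← sum_fiberwise_of_maps_to (fun x _ => hw_mem_range x) fun x => |A x - B x|]
  gcongr with k
  rw [← sum_sub_distrib]
  exact abs_sum_le_sum_abs _ _

/-- Symmetric distributions are as far apart as their weight distributions. -/
theorem tvd_eq_tvW_of_symmetric {n : ℕ} {A B : (Fin n → Bool) → ℝ}
    (hA : ∀ x y, hw x = hw y → A x = A y) (hB : ∀ x y, hw x = hw y → B x = B y) :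
    tvd A B = tvW A B := by
  unfold tvW tvd wd
  rw [← sum_fiberwise_of_maps_to (fun x _ => hw_mem_range x) fun x => |A x - B x|]
  congr 1
  refine sum_congr rfl fun k _ => ?_
  rw [← sum_sub_distrib]
  obtain hs | ⟨y, hy⟩ := (univ.filter fun x : Fin n → Bool => hw x = k).eq_empty_or_nonempty
  · simp [hs]
  have h : ∀ x ∈ univ.filter (fun x : Fin n → Bool => hw x = k), A x - B x = A y - B y := by
    intro x hx
    have hxy : hw x = hw y := (mem_filter.1 hx).2.trans (mem_filter.1 hy).2.symm
    rw [hA x y hxy, hB x y hxy]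
  rw [sum_congr rfl h, sum_congr rfl fun x hx => congrArg abs (h x hx)]
  rw [sum_const, sum_const, abs_nsmul]

/-- For symmetric `M` and `D`, `dTV(A, M) ≤ dTV(|A|, |M|) + 3·dTV(A, D)`. -/
theorem stmt15 {n : ℕ} (A M D : (Fin n → Bool) → ℝ)
    (hA0 : ∀ x, 0 ≤ A x) (hA1 : ∑ x, A x = 1)
    (hM0 : ∀ x, 0 ≤ M x) (hM1 : ∑ x, M x = 1)
    (hD0 : ∀ x, 0 ≤ D x) (hD1 : ∑ x, D x = 1)
    (hMsym : ∀ x y, hw x = hw y → M x = M y)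
    (hDsym : ∀ x y, hw x = hw y → D x = D y) :
    tvd A M ≤ tvW A M + 3 * tvd A D := by
  have hADM := tvd_triangle A D M
  have hDAM := tvW_triangle D A M
  have hDA := tvW_le_tvd D A
  rw [tvd_eq_tvW_of_symmetric hDsym hMsym] at hADM
  rw [tvd_comm] at hDA
  linarith [tvd_nonneg A D]
end
end
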